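/- In every hypergraph H of d-intervals (d ≥ 2), the covering number satisfies τ(H) ≤ (d² − d + 1)·ν(H). -/

import Mathlib

/-- A `d`-interval: a union of at most `d` (and at least one) pairwise disjoint nonempty
closed intervals in `ℝ`. -/
def IsDInterval (d : ℕ) (h : Set ℝ) : Prop :=
  ∃ (n : ℕ) (a b : Fin n → ℝ), 1 ≤ n ∧ n ≤ d ∧ (∀ i, a i ≤ b i) ∧
    (∀ i j : Fin n, i ≠ j → Disjoint (Set.Icc (a i) (b i)) (Set.Icc (a j) (b j))) ∧
    h = ⋃ i, Set.Icc (a i) (b i)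

/-- A separated `d`-interval: `d` disjoint nonempty closed interval components, the `i`-th
component (for `i ∈ {0, …, d-1}`) lying in the open interval `(i, i+1)`. -/
def IsSeparatedDInterval (d : ℕ) (h : Set ℝ) : Prop :=
  ∃ a b : Fin d → ℝ, (∀ i, a i ≤ b i) ∧
    (∀ i : Fin d, Set.Icc (a i) (b i) ⊆ Set.Ioo (i : ℝ) ((i : ℝ) + 1)) ∧
    h = ⋃ i, Set.Icc (a i) (b i)

/-- `C` is a cover (piercing set) of the hypergraph with edge set `F`: every edge contains
a point of `C`. -/
def IsCover (F : Finset (Set ℝ)) (C : Finset ℝ) : Prop :=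
  ∀ e ∈ F, ∃ p ∈ C, p ∈ e

/-- The covering (piercing) number `τ`: the minimal size of a cover. -/
noncomputable def piercingNumber (F : Finset (Set ℝ)) : ℕ :=
  sInf {n : ℕ | ∃ C : Finset ℝ, IsCover F C ∧ C.card = n}

/-- `M` is a matching of the hypergraph with edge set `F`: a set of pairwise disjoint
edges of `F`. -/
def IsMatching (F M : Finset (Set ℝ)) : Prop :=
  M ⊆ F ∧ ∀ e ∈ M, ∀ f ∈ M, e ≠ f → Disjoint e f

/-- The matching number `ν`: the maximal size of a matching. -/
noncomputable def matchingNumber (F : Finset (Set ℝ)) : ℕ :=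
  sSup {n : ℕ | ∃ M : Finset (Set ℝ), IsMatching F M ∧ M.card = n}

/-- A finite set `S` is dominant for the orders induced by `ρ i`, `i : I`, if no point `y` lies
strictly above the `ρ i`-minimum of `S` for all `i` simultaneously. -/
def Dominant {V I : Type*} (ρ : I → V → ℕ) (S : Finset V) : Prop :=
  ∀ y, ∃ i, ∀ x ∈ S, ρ i y ≤ ρ i x

theorem Dominant.mono {V I : Type*} {ρ : I → V → ℕ} {S S' : Finset V} (h : Dominant ρ S)
    (hS : S' ⊆ S) : Dominant ρ S' :=
  fun y => (h y).imp fun _ hi x hx => hi x (hS hx)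

theorem exists_argmin {V I : Type*} (ρ : I → V → ℕ) {S : Finset V} (hS : S.Nonempty) :
    ∃ m : I → V, ∀ i, m i ∈ S ∧ ∀ x ∈ S, ρ i (m i) ≤ ρ i x := by
  choose m hm using fun i => S.exists_min_image (ρ i) hS
  exact ⟨m, hm⟩

theorem Dominant.exists_eq_argmin {V I : Type*} {ρ : I → V → ℕ}
    (hρ : ∀ i, Function.Injective (ρ i)) {S : Finset V} (h : Dominant ρ S) {m : I → V}
    (hm : ∀ i, m i ∈ S ∧ ∀ x ∈ S, ρ i (m i) ≤ ρ i x) {x : V} (hx : x ∈ S) : ∃ i, m i = x := by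
  obtain ⟨i, hi⟩ := h x
  exact ⟨i, hρ i (le_antisymm ((hm i).2 x hx) (hi _ (hm i).1))⟩

/-- A dominant set with one element less than the number of orders extends to a dominant set in
exactly two ways, provided that no index `k` obstructs the extension. -/
theorem Dominant.exists_two_extensions {V I : Type*} [Fintype V] [DecidableEq V] [Fintype I]
    {ρ : I → V → ℕ} (hρ : ∀ i, Function.Injective (ρ i)) {S : Finset V} (h : Dominant ρ S)
    (hcard : S.card + 1 = Fintype.card I) (hS : S.Nonempty)
    (hext : ∀ k, ∃ y, ∀ j, j ≠ k → ∃ x ∈ S, ρ j x < ρ j y) :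
    ∃ p q, p ≠ q ∧ ∀ x, (x ∉ S ∧ Dominant ρ (insert x S)) ↔ x = p ∨ x = q := by
  classical
  obtain ⟨m, hm⟩ := exists_argmin ρ hS
  obtain ⟨a, -, b, -, hab, hmab⟩ := Finset.exists_ne_map_eq_of_card_lt_of_maps_to
    (s := (Finset.univ : Finset I)) (t := S) (f := m) (by rw [Finset.card_univ]; omega)
    (fun i _ => (hm i).1)
  have key : ∀ k, ∃ x, (∀ j, j ≠ k → ρ j (m j) < ρ j x) ∧
      ∀ y, (∀ j, j ≠ k → ρ j (m j) < ρ j y) → ρ k y ≤ ρ k x := by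
    intro k
    obtain ⟨y, hy⟩ := hext k
    obtain ⟨x, hx, hx'⟩ := Finset.exists_max_image
      (Finset.univ.filter fun y => ∀ j, j ≠ k → ρ j (m j) < ρ j y) (ρ k)
      ⟨y, by
        simp only [Finset.mem_filter, Finset.mem_univ, true_and]
        intro j hj
        obtain ⟨x, hx, hxy⟩ := hy j hj
        exact ((hm j).2 x hx).trans_lt hxy⟩
    simp only [Finset.mem_filter, Finset.mem_univ, true_and] at hx hx'
    exact ⟨x, hx, hx'⟩
  have above : ∀ k x, (∀ j, j ≠ k → ρ j (m j) < ρ j x) → ∀ z ∈ S, ρ k x ≤ ρ k z := by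
    intro k x hx z hz
    obtain ⟨i, hi⟩ := h x
    have : i = k := by
      by_contra hik
      exact absurd (hi _ (hm i).1) (not_le.2 (hx i hik))
    exact this ▸ hi z hz
  have extend : ∀ k l x, k ≠ l → m k = m l → (∀ j, j ≠ k → ρ j (m j) < ρ j x) →
      (∀ y, (∀ j, j ≠ k → ρ j (m j) < ρ j y) → ρ k y ≤ ρ k x) →
      x ∉ S ∧ Dominant ρ (insert x S) := by
    intro k l x hkl hml hx hmax
    refine ⟨fun hxS => ?_, fun y => ?_⟩
    · obtain ⟨j, rfl⟩ := h.exists_eq_argmin hρ hm hxS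
      have : j = k := by
        by_contra hjk
        exact lt_irrefl _ (hx j hjk)
      subst this
      have := hx l hkl.symm
      rw [hml] at this
      exact lt_irrefl _ this
    · by_cases hy : ∀ j, j ≠ k → ρ j (m j) < ρ j y
      · refine ⟨k, fun z hz => ?_⟩
        rcases Finset.mem_insert.1 hz with rfl | hz
        · exact hmax y hy
        · exact above k y hy z hz
      · push Not at hy
        obtain ⟨j, hjk, hj⟩ := hy
        refine ⟨j, fun z hz => ?_⟩
        rcases Finset.mem_insert.1 hz with rfl | hz
        · exact hj.trans (hx j hjk).le
        · exact hj.trans ((hm j).2 z hz)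
  obtain ⟨p, hp, hp'⟩ := key a
  obtain ⟨q, hq, hq'⟩ := key b
  refine ⟨p, q, ?_, fun x => ⟨?_, ?_⟩⟩
  · rintro rfl
    exact absurd (above a p hp (m a) (hm a).1) (not_le.2 (hq a hab))
  · rintro ⟨hxS, hdom⟩
    obtain ⟨m', hm'⟩ := exists_argmin ρ (Finset.insert_nonempty x S)
    have hsurj : ∀ z ∈ insert x S, ∃ i ∈ Finset.univ, m' i = z := fun z hz => by
      simpa using hdom.exists_eq_argmin hρ hm' hz
    have hinj : ∀ i j, m' i = m' j → i = j := fun i j hij =>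
      Finset.inj_on_of_surj_on_of_card_le (s := (Finset.univ : Finset I)) (t := insert x S)
        (fun i _ => m' i) (fun i _ => (hm' i).1) (fun z hz => by
          obtain ⟨i, hi, rfl⟩ := hsurj z hz
          exact ⟨i, hi, rfl⟩)
        (by rw [Finset.card_insert_of_notMem hxS, Finset.card_univ]; omega)
        (Finset.mem_univ i) (Finset.mem_univ j) hij
    obtain ⟨k, -, hk⟩ := hsurj x (Finset.mem_insert_self x S)
    have hmm : ∀ j, j ≠ k → m' j = m j := by
      intro j hj
      have h1 : m' j ∈ S := by
        refine (Finset.mem_insert.1 (hm' j).1).resolve_left fun h => hj (hinj _ _ ?_)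
        rw [h, hk]
      exact hρ j (le_antisymm ((hm' j).2 _ (Finset.mem_insert_of_mem (hm j).1)) ((hm j).2 _ h1))
    have hx : ∀ j, j ≠ k → ρ j (m j) < ρ j x := by
      intro j hj
      rw [← hmm j hj]
      refine lt_of_le_of_ne ((hm' j).2 x (Finset.mem_insert_self x S)) fun h => hj (hinj _ _ ?_)
      rw [hρ j h, hk]
    have hmax : ∀ y, (∀ j, j ≠ k → ρ j (m j) < ρ j y) → ρ k y ≤ ρ k x := by
      intro y hy
      obtain ⟨i, hi⟩ := hdom y
      have : i = k := by
        by_contra hik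
        exact absurd (hi _ (Finset.mem_insert_of_mem (hm i).1)) (not_le.2 (hy i hik))
      exact this ▸ hi x (Finset.mem_insert_self x S)
    have hkab : k = a ∨ k = b := by
      by_contra! hne
      refine hab (hinj a b ?_)
      rw [hmm a hne.1.symm, hmm b hne.2.symm, hmab]
    rcases hkab with rfl | rfl
    · exact Or.inl (hρ k (le_antisymm (hp' x hx) (hmax p hp)))
    · exact Or.inr (hρ k (le_antisymm (hq' x hx) (hmax q hq)))
  · rintro (rfl | rfl)
    · exact extend a b x hab hmab hp hp'
    · exact extend b a x hab.symm hmab.symm hq hq'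

/-- A set that misses exactly one colour has either no or exactly two elements whose removal
leaves a rainbow set with the same colours. -/
theorem even_card_filter_image_erase {V I : Type*} [DecidableEq V] [Fintype I] [DecidableEq I]
    (c : V → I) (i₀ : I) {S : Finset V} (hcard : S.card = Fintype.card I)
    (hc : S.image c ≠ Finset.univ) :
    Even (S.filter fun x => (S.erase x).image c = Finset.univ.erase i₀).card := by
  rcases (S.filter fun x => (S.erase x).image c = Finset.univ.erase i₀).eq_empty_or_nonempty with
    h0 | ⟨x, hx⟩
  · simp [h0]
  rw [Finset.mem_filter] at hx
  obtain ⟨hxS, hx⟩ := hx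
  have hinj : ∀ z ∈ S, (S.erase z).image c = Finset.univ.erase i₀ →
      Set.InjOn c (S.erase z : Finset V) := fun z hz h => by
    apply Finset.card_image_iff.1
    rw [h, Finset.card_erase_of_mem (Finset.mem_univ _), Finset.card_erase_of_mem hz, hcard,
      Finset.card_univ]
  have himage : ∀ z ∈ S, S.image c = insert (c z) ((S.erase z).image c) := fun z hz => by
    rw [← Finset.image_insert, Finset.insert_erase hz]
  have hcx : c x ≠ i₀ := by
    rintro h
    apply hc
    rw [himage x hxS, hx, h, Finset.insert_erase (Finset.mem_univ _)]
  obtain ⟨p, hp, hpx⟩ : ∃ p ∈ S.erase x, c p = c x := by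
    rw [← Finset.mem_image, hx]
    simpa using hcx
  rw [Finset.mem_erase] at hp
  have : (S.filter fun x => (S.erase x).image c = Finset.univ.erase i₀) = {x, p} := by
    ext z
    simp only [Finset.mem_filter, Finset.mem_insert, Finset.mem_singleton]
    refine ⟨fun ⟨hz, h⟩ => ?_, ?_⟩
    · by_contra! hne
      refine hp.1 (hinj z hz h ?_ ?_ hpx) <;> simp [hp.2, hxS, hne.1.symm, hne.2.symm]
    · rintro (rfl | rfl)
      · exact ⟨hxS, hx⟩
      · refine ⟨hp.2, ?_⟩
        rw [← hx]
        ext i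
        simp only [Finset.mem_image, Finset.mem_erase]
        constructor
        · rintro ⟨w, ⟨hw, hwS⟩, rfl⟩
          by_cases hwx : w = x
          · exact ⟨z, hp, by rw [hwx, hpx]⟩
          · exact ⟨w, ⟨hwx, hwS⟩, rfl⟩
        · rintro ⟨w, ⟨hw, hwS⟩, rfl⟩
          by_cases hwx : w = z
          · exact ⟨x, ⟨hp.1.symm, hxS⟩, by rw [hwx, hpx]⟩
          · exact ⟨w, ⟨hwx, hwS⟩, rfl⟩
  rw [this, Finset.card_pair hp.1.symm]
  exact even_two

/-- **Scarf's lemma** for injective orders with slack elements `e i`. -/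
theorem exists_dominant_image_eq_univ {V I : Type*} [Fintype V] [DecidableEq V] [Fintype I]
    [DecidableEq I] [Nonempty I] {ρ : I → V → ℕ} (hρ : ∀ i, Function.Injective (ρ i))
    (c : V → I) (e : I → V) (hce : ∀ i, c (e i) = i) (hbot : ∀ i v, ρ i (e i) ≤ ρ i v)
    (htop : ∀ i j v, i ≠ j → v ∉ Set.range e → ρ i v < ρ i (e j))
    (hne : ∃ v, v ∉ Set.range e) :
    ∃ S : Finset V, Dominant ρ S ∧ S.image c = Finset.univ ∧ S.card = Fintype.card I := by
  classical
  by_contra! hcon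
  obtain ⟨i₀⟩ := ‹Nonempty I›
  set R : Finset (Finset V) := Finset.univ.filter fun S => Dominant ρ S ∧ S.card = Fintype.card I
  set D : Finset (Finset V) := Finset.univ.filter fun S =>
    Dominant ρ S ∧ S.card + 1 = Fintype.card I ∧ S.image c = Finset.univ.erase i₀
  have hsum := Finset.sum_card_bipartiteAbove_eq_sum_card_bipartiteBelow (s := D) (t := R)
    (fun S S' => S ⊆ S')
  have heven : Even (∑ S ∈ R, (D.bipartiteBelow (fun S S' => S ⊆ S') S).card) := by
    refine Finset.even_sum _ fun S hS => ?_
    simp only [R, Finset.mem_filter, Finset.mem_univ, true_and] at hS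
    have := even_card_filter_image_erase c i₀ hS.2 fun h => hcon S hS.1 h hS.2
    refine Eq.subst (motive := Even) ?_ this
    refine Finset.card_bij (fun x _ => S.erase x) ?_ ?_ ?_
    · intro x hx
      simp only [Finset.mem_filter] at hx
      simp only [Finset.mem_bipartiteBelow, D, Finset.mem_filter, Finset.mem_univ, true_and]
      exact ⟨⟨hS.1.mono (Finset.erase_subset _ _), by
        rw [Finset.card_erase_add_one hx.1, hS.2], hx.2⟩, Finset.erase_subset _ _⟩
    · intro x hx y hy hxy
      simp only [Finset.mem_filter] at hx hy
      exact (Finset.erase_inj _ hx.1).1 hxy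
    · intro T hT
      simp only [Finset.mem_bipartiteBelow, D, Finset.mem_filter, Finset.mem_univ, true_and] at hT
      obtain ⟨⟨-, hT1, hT2⟩, hTS⟩ := hT
      obtain ⟨x, hx, rfl⟩ := (Finset.exists_eq_insert_iff (s := T) (t := S)).2 ⟨hTS, by omega⟩
      refine ⟨x, ?_, Finset.erase_insert hx⟩
      simp [Finset.erase_insert hx, hT2]
  have hext : ∀ S ∈ D, (R.bipartiteAbove (fun S S' => S ⊆ S') S).card =
      (Finset.univ.filter fun x => x ∉ S ∧ Dominant ρ (insert x S)).card := by
    intro S hS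
    simp only [D, Finset.mem_filter, Finset.mem_univ, true_and] at hS
    symm
    refine Finset.card_bij (fun x _ => insert x S) ?_ ?_ ?_
    · intro x hx
      simp only [Finset.mem_filter, Finset.mem_univ, true_and] at hx
      simp only [Finset.mem_bipartiteAbove, R, Finset.mem_filter, Finset.mem_univ, true_and]
      exact ⟨⟨hx.2, by rw [Finset.card_insert_of_notMem hx.1, hS.2.1]⟩, Finset.subset_insert _ _⟩
    · intro x hx y hy hxy
      simp only [Finset.mem_filter, Finset.mem_univ, true_and] at hx hy
      exact (Finset.insert_inj hx.1).1 hxy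
    · intro T hT
      simp only [Finset.mem_bipartiteAbove, R, Finset.mem_filter, Finset.mem_univ, true_and] at hT
      obtain ⟨x, hx, rfl⟩ := (Finset.exists_eq_insert_iff (s := S) (t := T)).2 ⟨hT.2, by omega⟩
      exact ⟨x, by simpa using ⟨hx, hT.1.1⟩, rfl⟩
  have heinj : Function.Injective e := fun i j hij => by rw [← hce i, hij, hce]
  set S₀ : Finset V := (Finset.univ.erase i₀).image e
  have hS₀ : S₀ ∈ D := by
    simp only [D, Finset.mem_filter, Finset.mem_univ, true_and, S₀]
    refine ⟨?_, ?_, ?_⟩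
    · intro y
      by_cases hy : y ∈ Set.range e
      · obtain ⟨k, rfl⟩ := hy
        exact ⟨k, fun x _ => hbot k x⟩
      · refine ⟨i₀, fun x hx => ?_⟩
        obtain ⟨j, hj, rfl⟩ := Finset.mem_image.1 hx
        exact (htop _ _ _ (Finset.ne_of_mem_erase hj).symm hy).le
    · rw [Finset.card_image_of_injective _ heinj, Finset.card_erase_add_one (Finset.mem_univ _),
        Finset.card_univ]
    · rw [Finset.image_image]
      rw [show c ∘ e = id from funext hce, Finset.image_id]
  have hone : (R.bipartiteAbove (fun S S' => S ⊆ S') S₀).card = 1 := by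
    rw [hext _ hS₀, Finset.card_eq_one]
    obtain ⟨v, hv⟩ := hne
    obtain ⟨t, ht, htmax⟩ := Finset.exists_max_image
      (Finset.univ.filter fun v => v ∉ Set.range e) (ρ i₀) ⟨v, by simpa using hv⟩
    rw [Finset.mem_filter] at ht
    have ht := ht.2
    have htmax : ∀ y ∉ Set.range e, ρ i₀ y ≤ ρ i₀ t := fun y hy =>
      htmax y (Finset.mem_filter.2 ⟨Finset.mem_univ _, hy⟩)
    have hle : ∀ x, Dominant ρ (insert x S₀) → ∀ y ∉ Set.range e, ρ i₀ y ≤ ρ i₀ x := by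
      intro x hx y hy
      obtain ⟨i, hi⟩ := hx y
      by_cases h : i = i₀
      · exact h ▸ hi x (Finset.mem_insert_self _ _)
      · have h1 := hi (e i) (Finset.mem_insert_of_mem (Finset.mem_image_of_mem e
          (Finset.mem_erase.2 ⟨h, Finset.mem_univ _⟩)))
        exact absurd (hρ i (le_antisymm h1 (hbot i y))) fun h => hy ⟨i, h.symm⟩
    refine ⟨t, ?_⟩
    ext x
    simp only [Finset.mem_filter, Finset.mem_univ, true_and, Finset.mem_singleton]
    constructor
    · rintro ⟨hxS, hx⟩
      have hxe : x ∉ Set.range e := by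
        rintro ⟨k, rfl⟩
        have hk : k = i₀ := by
          by_contra hk
          exact hxS (Finset.mem_image_of_mem e (Finset.mem_erase.2 ⟨hk, Finset.mem_univ _⟩))
        subst hk
        exact ht ⟨k, hρ k (le_antisymm (hbot k t) (hle _ hx t ht))⟩
      exact hρ i₀ (le_antisymm (htmax x hxe) (hle x hx t ht))
    · rintro rfl
      refine ⟨fun h => ?_, fun y => ?_⟩
      · obtain ⟨j, -, hj⟩ := Finset.mem_image.1 h
        exact ht ⟨j, hj⟩
      · by_cases hy : y ∈ Set.range e
        · obtain ⟨k, rfl⟩ := hy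
          exact ⟨k, fun x _ => hbot k x⟩
        · refine ⟨i₀, fun z hz => ?_⟩
          rcases Finset.mem_insert.1 hz with rfl | hz
          · exact htmax y hy
          · obtain ⟨j, hj, rfl⟩ := Finset.mem_image.1 hz
            exact (htop _ _ _ (Finset.ne_of_mem_erase hj).symm hy).le
  have htwo : ∀ S ∈ D.erase S₀, (R.bipartiteAbove (fun S S' => S ⊆ S') S).card = 2 := by
    intro S hS
    obtain ⟨hSne, hSD⟩ := Finset.mem_erase.1 hS
    rw [hext S hSD]
    simp only [D, Finset.mem_filter, Finset.mem_univ, true_and] at hSD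
    obtain ⟨hdom, hcard, himage⟩ := hSD
    obtain ⟨t, htS, ht⟩ : ∃ t ∈ S, t ∉ Set.range e := by
      by_contra! hall
      refine hSne (Finset.eq_of_subset_of_card_le ?_ ?_)
      · intro x hx
        obtain ⟨j, rfl⟩ := hall x hx
        refine Finset.mem_image_of_mem e ?_
        rw [← himage]
        exact Finset.mem_image.2 ⟨_, hx, hce j⟩
      · refine Finset.card_image_le.trans ?_
        rw [Finset.card_erase_of_mem (Finset.mem_univ _), Finset.card_univ]
        omega
    obtain ⟨p, q, hpq, h⟩ := hdom.exists_two_extensions hρ hcard ⟨t, htS⟩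
      fun k => ⟨e k, fun j hj => ⟨t, htS, htop j k t hj ht⟩⟩
    rw [Finset.card_eq_two]
    exact ⟨p, q, hpq, by ext x; simp [h]⟩
  rw [← hsum, ← Finset.add_sum_erase _ _ hS₀, hone, Finset.sum_congr rfl htwo,
    Finset.sum_const] at heven
  rw [smul_eq_mul, Nat.even_add] at heven
  simp at heven

/-- **Scarf's lemma** for arbitrary coordinates: some nonempty set `σ` of points is dominant for
the set of its colours. -/
theorem exists_dominant_for_colours {T I : Type*} [Finite T] [Nonempty T] [Finite I]
    [DecidableEq I] (x : T → I → ℕ) (c : T → I) :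
    ∃ σ : Finset T, σ.Nonempty ∧ ∀ y, ∃ i ∈ σ.image c, ∀ z ∈ σ, x y i ≤ x z i := by
  classical
  cases nonempty_fintype T
  cases nonempty_fintype I
  have hI : Nonempty I := ‹Nonempty T›.map c
  obtain ⟨B, hB⟩ : ∃ B, ∀ t i, x t i < B := by
    refine ⟨∑ t, ∑ i, x t i + 1, fun t i => Nat.lt_succ_of_le ?_⟩
    calc x t i ≤ ∑ i, x t i := Finset.single_le_sum (fun _ _ => Nat.zero_le _) (Finset.mem_univ i)
      _ ≤ _ := Finset.single_le_sum (f := fun t => ∑ i, x t i) (fun _ _ => Nat.zero_le _)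
        (Finset.mem_univ t)
  let key : I → T ⊕ I → ℕ := fun i v =>
    Sum.elim (fun t => 1 + x t i) (fun j => if j = i then 0 else B + 1) v
  let n := Fintype.card (T ⊕ I)
  let f : T ⊕ I → ℕ := fun v => Fintype.equivFin (T ⊕ I) v
  have hf : ∀ v, f v < n := fun v => (Fintype.equivFin (T ⊕ I) v).2
  let ρ : I → T ⊕ I → ℕ := fun i v => n * key i v + f v
  have hdiv : ∀ i v, ρ i v / n = key i v := fun i v => by
    simp only [ρ]
    rw [Nat.mul_add_div (Nat.zero_lt_of_lt (hf v)), Nat.div_eq_of_lt (hf v), add_zero]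
  have hmod : ∀ i v, ρ i v % n = f v := fun i v => by
    simp only [ρ]
    rw [Nat.mul_add_mod, Nat.mod_eq_of_lt (hf v)]
  have hle : ∀ i u v, ρ i u ≤ ρ i v → key i u ≤ key i v := fun i u v h => by
    rw [← hdiv, ← hdiv]
    exact Nat.div_le_div_right h
  have hlt : ∀ i u v, key i u < key i v → ρ i u < ρ i v := fun i u v h =>
    lt_of_not_ge fun h' => absurd (hle i v u h') (not_le.2 h)
  have hρ : ∀ i, Function.Injective (ρ i) := fun i u v h => by
    have : f u = f v := by rw [← hmod i u, h, hmod]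
    exact (Fintype.equivFin (T ⊕ I)).injective (Fin.ext this)
  obtain ⟨S, hdom, himage, -⟩ := exists_dominant_image_eq_univ hρ (Sum.elim c id) Sum.inr
    (fun i => rfl)
    (by
      intro i v
      by_cases hv : v = Sum.inr i
      · rw [hv]
      · refine (hlt i _ _ ?_).le
        rcases v with t | j
        · simp [key]
        · have : j ≠ i := fun h => hv (by rw [h])
          simp [key, this])
    (by
      intro i j v hij hv
      rcases v with t | k
      · refine hlt i _ _ ?_
        have := hB t i
        simp only [key, Sum.elim_inl, Sum.elim_inr, if_neg hij.symm]
        omega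
      · exact absurd ⟨k, rfl⟩ hv)
    ⟨Sum.inl (Classical.arbitrary T), by simp⟩
  have hC : ∀ y : T, ∃ i, Sum.inr i ∉ S ∧ ∀ v ∈ S, ρ i (Sum.inl y) ≤ ρ i v := fun y => by
    obtain ⟨i, hi⟩ := hdom (Sum.inl y)
    refine ⟨i, fun h => ?_, hi⟩
    have := hle _ _ _ (hi _ h)
    simp [key] at this
  have hcol : ∀ i, Sum.inr i ∉ S → ∃ t, Sum.inl t ∈ S ∧ c t = i := fun i hi => by
    have h : i ∈ S.image (Sum.elim c id) := by rw [himage]; exact Finset.mem_univ i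
    obtain ⟨v, hv, hvi⟩ := Finset.mem_image.1 h
    rcases v with t | j
    · exact ⟨t, hv, hvi⟩
    · exact absurd (show Sum.inr i ∈ S from hvi ▸ hv) hi
  refine ⟨Finset.univ.filter fun t => Sum.inl t ∈ S, ?_, fun y => ?_⟩
  · obtain ⟨i, hi, -⟩ := hC (Classical.arbitrary T)
    obtain ⟨t, ht, -⟩ := hcol i hi
    exact ⟨t, by simpa using ht⟩
  · obtain ⟨i, hi, hiv⟩ := hC y
    obtain ⟨t, ht, htc⟩ := hcol i hi
    refine ⟨i, Finset.mem_image.2 ⟨t, by simpa using ht, htc⟩, fun z hz => ?_⟩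
    have := hle _ _ _ (hiv (Sum.inl z) (by simpa using hz))
    simpa [key] using this

/-- An approximate version of Brouwer's fixed point theorem on the standard simplex. -/
theorem exists_approx_fixedPoint_stdSimplex {I : Type*} [Fintype I] [Nonempty I]
    {g : (I → ℝ) → I → ℝ} (hg : ContinuousOn g (stdSimplex ℝ I))
    (hmaps : Set.MapsTo g (stdSimplex ℝ I) (stdSimplex ℝ I)) {ε : ℝ} (hε : 0 < ε) :
    ∃ p ∈ stdSimplex ℝ I, ∀ i, p i - ε ≤ g p i := by
  classical
  obtain ⟨δ, hδ, hgδ⟩ := Metric.uniformContinuousOn_iff.1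
    ((isCompact_stdSimplex ℝ I).uniformContinuousOn_of_continuous hg) (ε / 2) (by linarith)
  obtain ⟨N, hN⟩ := exists_nat_gt (Fintype.card I / min δ (ε / 2))
  have hmin : 0 < min δ (ε / 2) := lt_min hδ (by linarith)
  have hN0 : (0 : ℝ) < N := lt_of_le_of_lt (by positivity) hN
  rw [div_lt_iff₀ hmin, ← div_lt_iff₀' hN0] at hN
  let T := {x : I → ℕ // x ∈ Finset.piAntidiag Finset.univ N}
  have hT : ∀ x : T, ∑ i, x.1 i = N := fun x => (Finset.mem_piAntidiag.1 x.2).1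
  let pt : T → I → ℝ := fun x i => x.1 i / N
  have hpt : ∀ x, pt x ∈ stdSimplex ℝ I := fun x => by
    refine ⟨fun i => by positivity, ?_⟩
    simp only [pt]
    rw [← Finset.sum_div, ← Nat.cast_sum, hT, div_self hN0.ne']
  have : Finite T := inferInstanceAs (Finite {x // x ∈ Finset.piAntidiag Finset.univ N})
  have : Nonempty T := by
    obtain ⟨i⟩ := ‹Nonempty I›
    exact ⟨⟨Pi.single i N, by simp [Finset.mem_piAntidiag]⟩⟩
  have hcol : ∀ x, ∃ i, pt x i ≤ g (pt x) i := fun x => by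
    obtain ⟨i, -, hi⟩ := Finset.exists_le_of_sum_le (s := Finset.univ) Finset.univ_nonempty
      (f := pt x) (g := g (pt x)) (by rw [(hpt x).2, (hmaps (hpt x)).2])
    exact ⟨i, hi⟩
  choose c hc using hcol
  obtain ⟨σ, hσ, hdom⟩ := exists_dominant_for_colours (fun x : T => x.1) c
  choose m hmσ hm using fun i => σ.exists_min_image (fun x : T => x.1 i) hσ
  set C := σ.image c
  have hCne : C.Nonempty := hσ.image c
  have hlarge : N < ∑ i ∈ C, ((m i).1 i + 1) := by
    by_contra! hle
    obtain ⟨k, -⟩ := hCne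
    let y : I → ℕ := fun i => (if i ∈ C then (m i).1 i + 1 else 0) +
      if i = k then N - ∑ i ∈ C, ((m i).1 i + 1) else 0
    have hy : ∑ i, y i = N := by
      simp only [y, Finset.sum_add_distrib, Finset.sum_ite_mem, Finset.univ_inter,
        Finset.sum_ite_eq', Finset.mem_univ, if_true]
      rw [Finset.sum_add_distrib] at hle
      omega
    obtain ⟨i, hiC, hi⟩ := hdom ⟨y, by simp [Finset.mem_piAntidiag, hy]⟩
    have := hi (m i) (hmσ i)
    simp only [y, if_pos hiC] at this
    omega
  rw [Finset.sum_add_distrib, Finset.sum_const, smul_eq_mul, mul_one] at hlarge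
  have hCcard : C.card ≤ Fintype.card I := Finset.card_le_univ C
  have hmem : ∀ z ∈ σ, ∀ i ∈ C, z.1 i ≤ (m i).1 i + Fintype.card I := by
    intro z hz i hi
    have h1 : ∑ j ∈ C, z.1 j ≤ N :=
      (Finset.sum_le_univ_sum_of_nonneg fun _ => Nat.zero_le _).trans_eq (hT z)
    have h2 : ∑ j ∈ C.erase i, (m j).1 j ≤ ∑ j ∈ C.erase i, z.1 j :=
      Finset.sum_le_sum fun j _ => hm j z hz
    rw [← Finset.add_sum_erase _ _ hi] at h1 hlarge
    omega
  have hnmem : ∀ z ∈ σ, ∀ i ∉ C, z.1 i ≤ Fintype.card I := by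
    intro z hz i hi
    have h1 : ∑ j ∈ insert i C, z.1 j ≤ N :=
      (Finset.sum_le_univ_sum_of_nonneg fun _ => Nat.zero_le _).trans_eq (hT z)
    have h2 : ∑ j ∈ C, (m j).1 j ≤ ∑ j ∈ C, z.1 j := Finset.sum_le_sum fun j _ => hm j z hz
    rw [Finset.sum_insert hi] at h1
    omega
  have hclose : ∀ z ∈ σ, ∀ w ∈ σ, ∀ i, pt z i - pt w i ≤ Fintype.card I / N := by
    intro z hz w hw i
    simp only [pt]
    rw [← sub_div]
    gcongr
    rw [sub_le_iff_le_add']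
    have : z.1 i ≤ w.1 i + Fintype.card I := by
      by_cases hi : i ∈ C
      · exact (hmem z hz i hi).trans (Nat.add_le_add_right (hm i w hw) _)
      · exact (hnmem z hz i hi).trans (Nat.le_add_left _ _)
    exact_mod_cast this
  have hdist : ∀ z ∈ σ, ∀ w ∈ σ, dist (pt z) (pt w) ≤ Fintype.card I / N := by
    intro z hz w hw
    refine (dist_pi_le_iff (by positivity)).2 fun i => ?_
    rw [Real.dist_eq, abs_sub_le_iff]
    exact ⟨hclose z hz w hw i, hclose w hw z hz i⟩
  obtain ⟨z, hz⟩ := hσ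
  refine ⟨pt z, hpt z, fun i => ?_⟩
  by_cases hi : i ∈ C
  · obtain ⟨w, hw, rfl⟩ := Finset.mem_image.1 hi
    have h1 := hgδ _ (hpt z) _ (hpt w) ((hdist z hz w hw).trans_lt (hN.trans_le (min_le_left _ _)))
    have h2 := (dist_le_pi_dist _ _ (c w)).trans_lt h1
    rw [Real.dist_eq, abs_sub_lt_iff] at h2
    have h3 := hclose z hz w hw (c w)
    have h4 := hc w
    have h5 := hN.le.trans (min_le_right _ _)
    linarith [h2.2]
  · have h1 : pt z i ≤ Fintype.card I / N := by
      simp only [pt]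
      gcongr
      exact_mod_cast hnmem z hz i hi
    have h2 := (hmaps (hpt z)).1 i
    have h5 := hN.le.trans (min_le_right _ _)
    linarith

/-- **Brouwer's fixed point theorem** for the standard simplex. -/
theorem exists_fixedPoint_stdSimplex {I : Type*} [Fintype I] [Nonempty I]
    {g : (I → ℝ) → I → ℝ} (hg : ContinuousOn g (stdSimplex ℝ I))
    (hmaps : Set.MapsTo g (stdSimplex ℝ I) (stdSimplex ℝ I)) :
    ∃ p ∈ stdSimplex ℝ I, g p = p := by
  classical
  let φ : (I → ℝ) → ℝ := fun p => Finset.univ.inf' Finset.univ_nonempty fun i => g p i - p i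
  have hφ : ContinuousOn φ (stdSimplex ℝ I) :=
    ContinuousOn.finset_inf'_apply _ fun i _ =>
      ((continuous_apply i).comp_continuousOn hg).sub (continuous_apply i).continuousOn
  obtain ⟨p₁, hp₁, -⟩ := exists_approx_fixedPoint_stdSimplex hg hmaps one_pos
  obtain ⟨p, hp, hmax⟩ := (isCompact_stdSimplex ℝ I).exists_isMaxOn ⟨p₁, hp₁⟩ hφ
  have h0 : 0 ≤ φ p := by
    refine le_of_forall_pos_le_add fun ε hε => ?_
    obtain ⟨q, hq, hqε⟩ := exists_approx_fixedPoint_stdSimplex hg hmaps hε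
    have h1 : -ε ≤ φ q := Finset.le_inf' _ _ fun i _ => by linarith [hqε i]
    have h2 : φ q ≤ φ p := hmax hq
    linarith
  have hle : ∀ i ∈ Finset.univ, p i ≤ g p i := fun i hi => by
    have : φ p ≤ g p i - p i := Finset.inf'_le _ hi
    linarith
  refine ⟨p, hp, funext fun i => ?_⟩
  exact ((Finset.sum_eq_sum_iff_of_le hle).1 (by rw [hp.2, (hmaps hp).2]) i
    (Finset.mem_univ i)).symm

/-- A continuous nonnegative function on the standard simplex with positive total, whose `i`-th
coordinate vanishes on the `i`-th facet, has all coordinates equal at some point. -/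
theorem exists_forall_eq_of_facet {I : Type*} [Fintype I] [Nonempty I]
    {f : (I → ℝ) → I → ℝ} (hf : ContinuousOn f (stdSimplex ℝ I))
    (hpos : ∀ x ∈ stdSimplex ℝ I, 0 < ∑ i, f x i)
    (hfacet : ∀ x ∈ stdSimplex ℝ I, ∀ i, x i = 0 → f x i = 0) :
    ∃ x ∈ stdSimplex ℝ I, ∃ c > 0, ∀ i, f x i = c := by
  classical
  let a : (I → ℝ) → ℝ := fun x => (∑ j, f x j) / Fintype.card I
  let u : (I → ℝ) → I → ℝ := fun x i => max 0 (a x - f x i)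
  let s : (I → ℝ) → ℝ := fun x => 1 + ∑ i, u x i
  let g : (I → ℝ) → I → ℝ := fun x i => (x i + u x i) / s x
  have hn : (0 : ℝ) < Fintype.card I := by exact_mod_cast Fintype.card_pos
  have hu : ∀ x i, 0 ≤ u x i := fun x i => le_max_left _ _
  have hs : ∀ x, 0 < s x := fun x => by
    have := Finset.sum_nonneg fun i (_ : i ∈ Finset.univ) => hu x i
    simp only [s]
    linarith
  have hfi : ∀ i, ContinuousOn (fun x => f x i) (stdSimplex ℝ I) := fun i =>
    (continuous_apply i).comp_continuousOn hf
  have hac : ContinuousOn a (stdSimplex ℝ I) :=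
    (continuousOn_finsetSum _ fun i _ => hfi i).div_const _
  have huc : ∀ i, ContinuousOn (fun x => u x i) (stdSimplex ℝ I) := fun i =>
    continuousOn_const.sup (hac.sub (hfi i))
  have hgc : ContinuousOn g (stdSimplex ℝ I) := continuousOn_pi.2 fun i =>
    ((continuous_apply i).continuousOn.add (huc i)).div
      (continuousOn_const.add (continuousOn_finsetSum _ fun i _ => huc i)) fun x _ => (hs x).ne'
  obtain ⟨x, hx, hgx⟩ := exists_fixedPoint_stdSimplex hgc (fun x hx => by
    refine ⟨fun i => div_nonneg (add_nonneg (hx.1 i) (hu x i)) (hs x).le, ?_⟩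
    simp only [g]
    rw [← Finset.sum_div, Finset.sum_add_distrib, hx.2]
    exact div_self (hs x).ne')
  have hax : 0 < a x := div_pos (hpos x hx) hn
  have hfix : ∀ i, x i * ∑ j, u x j = u x i := fun i => by
    have := congrFun hgx i
    simp only [g] at this
    rw [div_eq_iff (hs x).ne'] at this
    simp only [s] at this
    linarith
  have hsum : ∑ i, (f x i - a x) = 0 := by
    rw [Finset.sum_sub_distrib, Finset.sum_const, Finset.card_univ, nsmul_eq_mul]
    simp only [a]
    field_simp
    ring
  have hzero : ∑ j, u x j = 0 := by
    by_contra hne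
    have hlt : ∀ i, f x i < a x := by
      intro i
      by_contra! hle
      have h0 : u x i = 0 := max_eq_left (by linarith)
      have h1 := hfix i
      rw [h0] at h1
      have h2 := hfacet x hx i ((mul_eq_zero.1 h1).resolve_right hne)
      linarith
    have : ∑ i, (f x i - a x) < 0 :=
      Finset.sum_neg (fun i _ => by linarith [hlt i]) Finset.univ_nonempty
    linarith
  have hge : ∀ i ∈ Finset.univ, 0 ≤ f x i - a x := fun i hi => by
    have h1 := (Finset.sum_eq_zero_iff_of_nonneg fun i _ => hu x i).1 hzero i hi
    have h2 : a x - f x i ≤ u x i := le_max_right _ _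
    linarith
  refine ⟨x, hx, a x, hax, fun i => ?_⟩
  have := (Finset.sum_eq_zero_iff_of_nonneg hge).1 hsum i (Finset.mem_univ i)
  linarith

/-- If the direction `r` decreases some slack and keeps the zero slacks zero, then one can move
along it until a positive slack vanishes. -/
theorem exists_step_to_boundary {ι : Type*} [Finite ι] (s r : ι → ℝ) (hs : ∀ i, 0 ≤ s i)
    (hr : ∃ i, r i < 0) (htight : ∀ i, s i = 0 → r i = 0) :
    ∃ t : ℝ, 0 ≤ t ∧ (∀ i, 0 ≤ s i + t * r i) ∧ ∃ i, 0 < s i ∧ s i + t * r i = 0 := by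
  classical
  cases nonempty_fintype ι
  obtain ⟨i₀, hi₀⟩ := hr
  obtain ⟨i, hi, hmin⟩ := Finset.exists_min_image (Finset.univ.filter fun i => r i < 0)
    (fun i => s i / -r i) ⟨i₀, by simpa using hi₀⟩
  simp only [Finset.mem_filter, Finset.mem_univ, true_and] at hi hmin
  refine ⟨s i / -r i, div_nonneg (hs i) (by linarith), fun j => ?_, i, ?_, ?_⟩
  · rcases lt_or_ge (r j) 0 with hj | hj
    · have := hmin j hj
      rw [le_div_iff₀ (by linarith)] at this
      linarith
    · have := mul_nonneg (div_nonneg (hs i) (by linarith : 0 ≤ -r i)) hj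
      linarith [hs j]
  · exact lt_of_le_of_ne (hs i) fun h => hi.ne (htight i h.symm)
  · rw [div_neg, neg_mul, div_mul_cancel₀ _ hi.ne, add_neg_cancel]

/-- **Füredi's theorem**: for sets of size at most `d`, the total weight of a fractional matching
is at most `d - 1 + 1 / d` times the size of some matching. -/
theorem exists_matching_of_fractional {ε V : Type*} [DecidableEq ε] [Fintype V] [DecidableEq V]
    (T : ε → Finset V) {d : ℕ} (E : Finset ε) (y : ε → ℝ) (hT : ∀ e ∈ E, (T e).Nonempty)
    (hd : ∀ e ∈ E, (T e).card ≤ d) (hy : ∀ e ∈ E, 0 < y e)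
    (hfrac : ∀ v, ∑ e ∈ E with v ∈ T e, y e ≤ 1) :
    ∃ M ⊆ E, (∀ e ∈ M, ∀ f ∈ M, e ≠ f → Disjoint (T e) (T f)) ∧
      d * ∑ e ∈ E, y e ≤ ((d : ℝ) ^ 2 - d + 1) * M.card := by
  induction hm : E.card * (Fintype.card V + 1) +
      (Finset.univ.filter fun v => ∑ e ∈ E with v ∈ T e, y e ≠ 1).card
    using Nat.strong_induction_on generalizing E y with
  | _ m ih =>
  subst hm
  have hsmall : ∀ (E' : Finset ε) (y' : ε → ℝ), E' ⊆ E → E'.card < E.card →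
      (∀ e ∈ E', 0 < y' e) → (∀ v, ∑ e ∈ E' with v ∈ T e, y' e ≤ 1) →
      ∃ M ⊆ E', (∀ e ∈ M, ∀ f ∈ M, e ≠ f → Disjoint (T e) (T f)) ∧
        d * ∑ e ∈ E', y' e ≤ ((d : ℝ) ^ 2 - d + 1) * M.card := by
    intro E' y' hE' hcard hy' hfrac'
    refine ih _ ?_ E' y' (fun e he => hT e (hE' he)) (fun e he => hd e (hE' he)) hy' hfrac' rfl
    have h1 := Finset.card_le_univ
      (Finset.univ.filter fun v => ∑ e ∈ E' with v ∈ T e, y' e ≠ 1)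
    have h2 : (E'.card + 1) * (Fintype.card V + 1) ≤ E.card * (Fintype.card V + 1) :=
      Nat.mul_le_mul_right _ hcard
    rw [add_mul] at h2
    omega
  have hdouble : ∀ K : Finset V, ∑ v ∈ K, ∑ e ∈ E with v ∈ T e, y e =
      ∑ e ∈ E, (T e ∩ K).card * y e := fun K => by
    simp only [Finset.sum_filter]
    rw [Finset.sum_comm]
    refine Finset.sum_congr rfl fun e _ => ?_
    rw [← Finset.sum_filter, Finset.sum_const, nsmul_eq_mul, Finset.filter_mem_eq_inter,
      Finset.inter_comm]
  rcases E.eq_empty_or_nonempty with rfl | hEne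
  · exact ⟨∅, Finset.Subset.refl _, by simp, by simp⟩
  by_cases hbig : ∃ e ∈ E, 1 ≤ (T e).card * y e
  · obtain ⟨e₀, he₀, hlarge⟩ := hbig
    set E' := E.filter fun e => Disjoint (T e) (T e₀)
    have he₀' : e₀ ∉ E' := fun h => (hT e₀ he₀).ne_empty (by simpa using (Finset.mem_filter.1 h).2)
    have hsub : E' ⊆ E := Finset.filter_subset _ _
    obtain ⟨M, hME, hM, hle⟩ := hsmall E' y hsub
      (Finset.card_lt_card (Finset.ssubset_iff_of_subset hsub |>.2 ⟨e₀, he₀, he₀'⟩))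
      (fun e he => hy e (hsub he)) fun v => (Finset.sum_le_sum_of_subset_of_nonneg
        (Finset.filter_subset_filter _ hsub) fun e he _ =>
          (hy e (Finset.mem_filter.1 he).1).le).trans (hfrac v)
    refine ⟨insert e₀ M, Finset.insert_subset he₀ (hME.trans hsub), ?_, ?_⟩
    · have hdis : ∀ e ∈ M, Disjoint (T e) (T e₀) := fun e he => (Finset.mem_filter.1 (hME he)).2
      intro e he f hf hef
      rcases Finset.mem_insert.1 he with rfl | heM <;>
        rcases Finset.mem_insert.1 hf with rfl | hfM
      · exact absurd rfl hef
      · exact (hdis f hfM).symm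
      · exact hdis e heM
      · exact hM e heM f hfM hef
    · rw [Finset.card_insert_of_notMem fun h => he₀' (hME h)]
      have hdeg : ∑ e ∈ E, ((T e ∩ T e₀).card : ℝ) * y e ≤ (T e₀).card := by
        rw [← hdouble]
        exact (Finset.sum_le_sum fun v _ => hfrac v).trans (by simp)
      have hmeet : ∑ e ∈ E \ E', y e + ((T e₀).card - 1) * y e₀ ≤
          ∑ e ∈ E, ((T e ∩ T e₀).card : ℝ) * y e := by
        rw [← Finset.sum_sdiff hsub]
        have h0 : 0 ≤ ∑ e ∈ E', ((T e ∩ T e₀).card : ℝ) * y e :=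
          Finset.sum_nonneg fun e he => mul_nonneg (Nat.cast_nonneg _) (hy e (hsub he)).le
        have hmem : e₀ ∈ E \ E' := Finset.mem_sdiff.2 ⟨he₀, he₀'⟩
        rw [← Finset.add_sum_erase _ _ hmem, ← Finset.add_sum_erase (E \ E') (fun e =>
          ((T e ∩ T e₀).card : ℝ) * y e) hmem, Finset.inter_self]
        have h1 : ∑ e ∈ (E \ E').erase e₀, y e ≤
            ∑ e ∈ (E \ E').erase e₀, ((T e ∩ T e₀).card : ℝ) * y e := by
          refine Finset.sum_le_sum fun e he => ?_
          have he := Finset.mem_sdiff.1 (Finset.mem_of_mem_erase he)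
          refine le_mul_of_one_le_left (hy e he.1).le ?_
          have : (T e ∩ T e₀).Nonempty := by
            rw [← Finset.not_disjoint_iff_nonempty_inter]
            exact fun h => he.2 (Finset.mem_filter.2 ⟨he.1, h⟩)
          exact_mod_cast this.card_pos
        linarith
      have hsplit := Finset.sum_sdiff (f := y) hsub
      have hs1 : (1 : ℝ) ≤ (T e₀).card := by exact_mod_cast (hT e₀ he₀).card_pos
      have hsd : ((T e₀).card : ℝ) ≤ d := by exact_mod_cast hd e₀ he₀
      generalize ((T e₀).card : ℝ) = s at *
      have hremoved : d * ∑ e ∈ E \ E', y e ≤ (d : ℝ) ^ 2 - d + 1 := by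
        have h1 : ∑ e ∈ E \ E', y e ≤ s - (s - 1) * y e₀ := by linarith
        have h2 : d * ∑ e ∈ E \ E', y e ≤ d * (s - (s - 1) * y e₀) :=
          mul_le_mul_of_nonneg_left h1 (by linarith)
        have h3 : 1 / s ≤ y e₀ := by
          rw [div_le_iff₀ (by linarith)]
          linarith
        have h4 : d * (s - 1) * (1 / s) ≤ d * (s - 1) * y e₀ :=
          mul_le_mul_of_nonneg_left h3 (mul_nonneg (by linarith) (by linarith))
        have h5 : 1 / s ≤ 1 := by
          rw [div_le_one (by linarith)]
          exact hs1
        have h6 : s * (1 / s) = 1 := by field_simp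
        nlinarith [mul_nonneg (sub_nonneg.2 hsd) (by linarith : (0 : ℝ) ≤ d - 1 / s)]
      push_cast
      rw [← hsplit]
      linarith
  · push Not at hbig
    set K : Finset V := Finset.univ.filter fun v => ∑ e ∈ E with v ∈ T e, y e = 1
    have hKE : K.card < E.card := by
      have h1 : ∑ v ∈ K, ∑ e ∈ E with v ∈ T e, y e = K.card := by
        rw [Finset.sum_congr rfl fun v hv => (Finset.mem_filter.1 hv).2,
          Finset.sum_const, nsmul_eq_mul, mul_one]
      rw [hdouble] at h1
      have h2 : ∑ e ∈ E, ((T e ∩ K).card : ℝ) * y e < ∑ e ∈ E, (1 : ℝ) := by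
        refine Finset.sum_lt_sum_of_nonempty hEne fun e he => lt_of_le_of_lt ?_ (hbig e he)
        have := hy e he
        gcongr
        exact Finset.inter_subset_left
      rw [h1] at h2
      simpa using h2
    obtain ⟨z, hzE, hzK, e₁, he₁, hze₁⟩ : ∃ z : ε → ℝ, 0 ≤ ∑ e ∈ E, z e ∧
        (∀ v ∈ K, ∑ e ∈ E with v ∈ T e, z e = 0) ∧ ∃ e ∈ E, z e ≠ 0 := by
      let L : (E → ℝ) →ₗ[ℝ] (K → ℝ) := LinearMap.pi fun v =>
        ∑ e : E, if v.1 ∈ T e then LinearMap.proj e else 0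
      obtain ⟨w, hw, hw0⟩ := (Submodule.ne_bot_iff _).1
        (LinearMap.ker_ne_bot_of_finrank_lt (f := L) (by simpa using hKE))
      have hL : ∀ v ∈ K, ∑ e : E, (if v ∈ T e then w e else 0) = 0 := fun v hv => by
        have := congrFun (LinearMap.mem_ker.1 hw) ⟨v, hv⟩
        simp only [L, LinearMap.pi_apply, LinearMap.sum_apply, Pi.zero_apply] at this
        refine (Finset.sum_congr rfl fun e _ => ?_).trans this
        split_ifs <;> simp
      obtain ⟨e, he⟩ := Function.ne_iff.1 hw0
      let z : ε → ℝ := fun e => if h : e ∈ E then w ⟨e, h⟩ else 0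
      have hzw : ∀ e : E, z e = w e := fun e => by simp [z]
      have hz : ∀ v ∈ K, ∑ e ∈ E with v ∈ T e, z e = 0 := fun v hv => by
        rw [← hL v hv, Finset.sum_filter, ← Finset.sum_coe_sort E]
        exact Finset.sum_congr rfl fun e _ => by rw [hzw]
      have hze : z e ≠ 0 := by simpa [hzw] using he
      rcases le_total 0 (∑ e ∈ E, z e) with h | h
      · exact ⟨z, h, hz, e, e.2, hze⟩
      · refine ⟨-z, by simpa using h, fun v hv => ?_, e, e.2, by simpa using hze⟩
        simp [hz v hv]
    let s : E ⊕ V → ℝ := Sum.elim (fun e => y e) fun v => 1 - ∑ e ∈ E with v ∈ T e, y e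
    let r : E ⊕ V → ℝ := Sum.elim (fun e => z e) fun v => -∑ e ∈ E with v ∈ T e, z e
    obtain ⟨t, ht, hnonneg, i, hipos, hi⟩ := exists_step_to_boundary s r
      (by
        rintro (e | v)
        · exact (hy e e.2).le
        · exact sub_nonneg.2 (hfrac v))
      (by
        by_contra! hcon
        have hz : ∀ e ∈ E, 0 ≤ z e := fun e he => hcon (Sum.inl ⟨e, he⟩)
        obtain ⟨v, hv⟩ := hT e₁ he₁
        have h1 : 0 ≤ -∑ e ∈ E with v ∈ T e, z e := hcon (Sum.inr v)
        have h2 : z e₁ ≤ ∑ e ∈ E with v ∈ T e, z e :=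
          Finset.single_le_sum (fun e he => hz e (Finset.mem_filter.1 he).1)
            (Finset.mem_filter.2 ⟨he₁, hv⟩)
        exact hze₁ (le_antisymm (by linarith) (hz e₁ he₁)))
      (by
        rintro (e | v) h
        · exact absurd h (hy e e.2).ne'
        · have h : 1 - ∑ e ∈ E with v ∈ T e, y e = 0 := h
          exact neg_eq_zero.2 (hzK v (Finset.mem_filter.2 ⟨Finset.mem_univ _, by linarith⟩)))
    let y' : ε → ℝ := fun e => y e + t * z e
    have hsum : ∀ F : Finset ε, ∑ e ∈ F, y' e = ∑ e ∈ F, y e + t * ∑ e ∈ F, z e := fun F => by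
      rw [Finset.sum_add_distrib, Finset.mul_sum]
    have hy'0 : ∀ e ∈ E, 0 ≤ y' e := fun e he => hnonneg (Sum.inl ⟨e, he⟩)
    have hfrac' : ∀ v, ∑ e ∈ E with v ∈ T e, y' e ≤ 1 := fun v => by
      have : 0 ≤ (1 - ∑ e ∈ E with v ∈ T e, y e) + t * (-∑ e ∈ E with v ∈ T e, z e) :=
        hnonneg (Sum.inr v)
      rw [hsum]
      linarith
    have htotal : d * ∑ e ∈ E, y e ≤ d * ∑ e ∈ E, y' e := by
      rw [hsum]
      have := mul_nonneg ht hzE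
      gcongr
      linarith
    by_cases hall : ∀ e ∈ E, 0 < y' e
    · obtain ⟨M, hME, hM, hle⟩ := ih _ (by
        refine Nat.add_lt_add_left (Finset.card_lt_card (Finset.ssubset_iff_of_subset ?_ |>.2 ?_)) _
        · intro v hv
          simp only [Finset.mem_filter, Finset.mem_univ, true_and] at hv ⊢
          intro h
          refine hv ?_
          rw [hsum, hzK v (Finset.mem_filter.2 ⟨Finset.mem_univ _, h⟩), h]
          simp
        · rcases i with e | v
          · exact absurd hi (hall e e.2).ne'
          · have h1 : 0 < 1 - ∑ e ∈ E with v ∈ T e, y e := hipos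
            have h2 : (1 - ∑ e ∈ E with v ∈ T e, y e) +
              t * (-∑ e ∈ E with v ∈ T e, z e) = 0 := hi
            refine ⟨v, ?_, ?_⟩
            · simp only [Finset.mem_filter, Finset.mem_univ, true_and]
              exact fun h => by linarith
            · simp only [Finset.mem_filter, Finset.mem_univ, true_and, not_not]
              rw [hsum]
              linarith) E y' hT hd hall hfrac' rfl
      exact ⟨M, hME, hM, htotal.trans hle⟩
    · push Not at hall
      obtain ⟨e₂, he₂, hye₂⟩ := hall
      have hsub : E.filter (fun e => 0 < y' e) ⊆ E := Finset.filter_subset _ _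
      obtain ⟨M, hME, hM, hle⟩ := hsmall (E.filter fun e => 0 < y' e) y' hsub
        (Finset.card_lt_card (Finset.ssubset_iff_of_subset hsub |>.2
          ⟨e₂, he₂, fun h => absurd (Finset.mem_filter.1 h).2 (not_lt.2 hye₂)⟩))
        (fun e he => (Finset.mem_filter.1 he).2) fun v =>
          (Finset.sum_le_sum_of_subset_of_nonneg (Finset.filter_subset_filter _ hsub)
            fun e he _ => hy'0 e (Finset.mem_filter.1 he).1).trans (hfrac' v)
      refine ⟨M, hME.trans hsub, hM, htotal.trans (le_trans (le_of_eq ?_) hle)⟩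
      rw [Finset.sum_filter_of_ne fun e he h => lt_of_le_of_ne (hy'0 e he) h.symm]

theorem IsDInterval.isCompact {d : ℕ} {h : Set ℝ} (hh : IsDInterval d h) : IsCompact h := by
  obtain ⟨n, a, b, -, -, -, -, rfl⟩ := hh
  exact isCompact_iUnion fun _ => isCompact_Icc

theorem IsDInterval.nonempty {d : ℕ} {h : Set ℝ} (hh : IsDInterval d h) : h.Nonempty := by
  obtain ⟨n, a, b, hn, -, hab, -, rfl⟩ := hh
  exact ⟨a ⟨0, hn⟩, Set.mem_iUnion.2 ⟨_, Set.left_mem_Icc.2 (hab _)⟩⟩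

/-- The indices of the open gaps between consecutive cut points `t` that meet `h`. -/
noncomputable def hitGaps {n : ℕ} (t : Fin (n + 1) → ℝ) (h : Set ℝ) : Finset (Fin n) :=
  open Classical in
  Finset.univ.filter fun j => (h ∩ Set.Ioo (t j.castSucc) (t j.succ)).Nonempty

theorem mem_hitGaps {n : ℕ} {t : Fin (n + 1) → ℝ} {h : Set ℝ} {j : Fin n} :
    j ∈ hitGaps t h ↔ (h ∩ Set.Ioo (t j.castSucc) (t j.succ)).Nonempty := by
  simp [hitGaps]

/-- The distance from the set of cut points `t` to `h`. -/
noncomputable def clearance {n : ℕ} (t : Fin (n + 1) → ℝ) (h : Set ℝ) : ℝ :=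
  Finset.univ.inf' Finset.univ_nonempty fun k => Metric.infDist (t k) h

theorem clearance_nonneg {n : ℕ} (t : Fin (n + 1) → ℝ) (h : Set ℝ) : 0 ≤ clearance t h :=
  Finset.le_inf' _ _ fun _ _ => Metric.infDist_nonneg

theorem clearance_pos_iff {n : ℕ} {t : Fin (n + 1) → ℝ} {h : Set ℝ} (hc : IsClosed h)
    (hne : h.Nonempty) : 0 < clearance t h ↔ ∀ k, t k ∉ h := by
  simp [clearance, Finset.lt_inf'_iff, hc.notMem_iff_infDist_pos hne]

theorem clearance_le_infDist {n : ℕ} (t : Fin (n + 1) → ℝ) (h : Set ℝ) (k : Fin (n + 1)) :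
    clearance t h ≤ Metric.infDist (t k) h :=
  Finset.inf'_le _ (Finset.mem_univ k)

theorem clearance_le_add_dist {n : ℕ} (t t' : Fin (n + 1) → ℝ) (h : Set ℝ) :
    clearance t h ≤ clearance t' h + dist t t' := by
  rw [← sub_le_iff_le_add]
  refine Finset.le_inf' _ _ fun k _ => ?_
  rw [sub_le_iff_le_add]
  exact (clearance_le_infDist t h k).trans (Metric.infDist_le_infDist_add_dist.trans
    (add_le_add_right (dist_le_pi_dist t t' k) _))

/-- The clearance of `h`, cut off to `0` unless `h` meets the `j`-th gap, depends continuously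
on the cut points. -/
theorem continuous_ite_clearance {n : ℕ} (h : Set ℝ) (j : Fin n) :
    Continuous fun t : Fin (n + 1) → ℝ => if j ∈ hitGaps t h then clearance t h else 0 := by
  refine (LipschitzWith.of_le_add fun t t' => ?_).continuous
  by_cases ht : j ∈ hitGaps t h <;> by_cases ht' : j ∈ hitGaps t' h <;>
    simp only [ht, ht', if_true, if_false]
  · exact clearance_le_add_dist t t' h
  · obtain ⟨p, hp, hp1, hp2⟩ := mem_hitGaps.1 ht
    have hclose : ∀ k, clearance t h ≤ |t k - p| := fun k =>
      (clearance_le_infDist t h k).trans (Metric.infDist_le_dist_of_mem hp)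
    have hdist : ∀ k, |t k - t' k| ≤ dist t t' := fun k => dist_le_pi_dist t t' k
    rw [zero_add]
    by_cases hp3 : t' j.castSucc < p
    · have hp4 : t' j.succ ≤ p := by
        by_contra! hp4
        exact ht' (mem_hitGaps.2 ⟨p, hp, hp3, hp4⟩)
      have h1 := hclose j.succ
      have h2 := hdist j.succ
      rw [abs_of_pos (by linarith)] at h1 h2
      linarith
    · have h1 := hclose j.castSucc
      have h2 := hdist j.castSucc
      rw [abs_of_neg (by linarith)] at h1
      rw [abs_of_nonpos (by linarith)] at h2
      linarith
  · exact add_nonneg (clearance_nonneg _ _) dist_nonneg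
  · simp

theorem exists_gap_of_forall_ne {n : ℕ} {t : Fin (n + 1) → ℝ} {p : ℝ} (h0 : t 0 < p)
    (hlast : p < t (Fin.last n)) (hne : ∀ k, t k ≠ p) :
    ∃ j : Fin n, p ∈ Set.Ioo (t j.castSucc) (t j.succ) := by
  by_contra! hcon
  have : ∀ k, t k < p := fun k => by
    induction k using Fin.induction with
    | zero => exact h0
    | succ j ih => exact lt_of_le_of_ne (not_lt.1 fun h => hcon j ⟨ih, h⟩) (hne _)
  exact lt_asymm hlast (this _)

theorem IsDInterval.card_hitGaps_le {d n : ℕ} {h : Set ℝ} (hh : IsDInterval d h)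
    {t : Fin (n + 1) → ℝ} (ht : Monotone t) (hth : ∀ k, t k ∉ h) : (hitGaps t h).card ≤ d := by
  obtain ⟨m, a, b, -, hmd, -, -, rfl⟩ := hh
  have hcomp : ∀ j : hitGaps t (⋃ i, Set.Icc (a i) (b i)),
      ∃ i, ∃ p ∈ Set.Icc (a i) (b i), p ∈ Set.Ioo (t j.1.castSucc) (t j.1.succ) := fun j => by
    obtain ⟨p, hp, hpj⟩ := mem_hitGaps.1 j.2
    obtain ⟨i, hi⟩ := Set.mem_iUnion.1 hp
    exact ⟨i, p, hi, hpj⟩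
  choose i p hp hpj using hcomp
  have hlt : ∀ j k, i j = i k → ¬ j.1 < k.1 := fun j k hjk hlt => by
    have h1 : t j.1.succ ≤ t k.1.castSucc := ht (Fin.le_def.2 hlt)
    refine hth j.1.succ (Set.mem_iUnion.2 ⟨i j, (hp j).1.trans (hpj j).2.le, ?_⟩)
    rw [hjk]
    exact (h1.trans (hpj k).1.le).trans (hp k).2
  have hinj : Function.Injective i := fun j k hjk =>
    Subtype.ext (le_antisymm (not_lt.1 (hlt k j hjk.symm)) (not_lt.1 (hlt j k hjk)))
  simpa using (Fintype.card_le_of_injective i hinj).trans (by simpa using hmd)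

theorem piercingNumber_le_card {F : Finset (Set ℝ)} {C : Finset ℝ} (hC : IsCover F C) :
    piercingNumber F ≤ C.card :=
  Nat.sInf_le ⟨C, hC, rfl⟩

theorem card_le_matchingNumber {F M : Finset (Set ℝ)} (hM : IsMatching F M) :
    M.card ≤ matchingNumber F := by
  refine le_csSup ⟨F.card, ?_⟩ ⟨M, hM, rfl⟩
  rintro _ ⟨N, hN, rfl⟩
  exact Finset.card_le_card hN.1

/-- The points that cut `[-L, L]` into consecutive intervals with lengths proportional to `x`. -/
noncomputable def cutPoints {n : ℕ} (L : ℝ) (x : Fin n → ℝ) (k : Fin (n + 1)) : ℝ :=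
  -L + 2 * L * ∑ i with Fin.castSucc i < k, x i

theorem continuous_cutPoints {n : ℕ} (L : ℝ) : Continuous (cutPoints (n := n) L) := by
  unfold cutPoints
  fun_prop

theorem cutPoints_zero {n : ℕ} (L : ℝ) (x : Fin n → ℝ) : cutPoints L x 0 = -L := by
  simp [cutPoints]

theorem cutPoints_last {n : ℕ} (L : ℝ) {x : Fin n → ℝ} (hx : x ∈ stdSimplex ℝ (Fin n)) :
    cutPoints L x (Fin.last n) = L := by
  simp only [cutPoints, Fin.castSucc_lt_last, Finset.filter_true, hx.2]
  ring

theorem monotone_cutPoints {n : ℕ} {L : ℝ} (hL : 0 < L) {x : Fin n → ℝ}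
    (hx : x ∈ stdSimplex ℝ (Fin n)) : Monotone (cutPoints L x) := fun j k hjk => by
  unfold cutPoints
  refine add_le_add_right (mul_le_mul_of_nonneg_left ?_ (by positivity)) _
  exact Finset.sum_le_sum_of_subset_of_nonneg
    (Finset.monotone_filter_right _ fun i _ hi => lt_of_lt_of_le hi hjk) fun i _ _ => hx.1 i

theorem cutPoints_succ_of_eq_zero {n : ℕ} (L : ℝ) {x : Fin n → ℝ} {j : Fin n} (hj : x j = 0) :
    cutPoints L x j.succ = cutPoints L x j.castSucc := by
  unfold cutPoints
  congr 2
  symm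
  refine Finset.sum_subset (Finset.monotone_filter_right _ fun i _ hi =>
    hi.trans (Fin.castSucc_lt_succ)) fun i hi hi' => ?_
  simp only [Finset.mem_filter, Finset.mem_univ, true_and, Fin.lt_def, Fin.val_castSucc,
    Fin.val_succ] at hi hi'
  rw [show i = j from Fin.ext (by omega), hj]

/-- Fewer than `τ` cut points miss some edge. -/
theorem exists_edge_forall_cutPoints_notMem {n : ℕ} {H : Finset (Set ℝ)} (hn : 0 < n)
    (hτ : n ≤ piercingNumber H) {L : ℝ} (hL : ∀ h ∈ H, h ⊆ Set.Ioo (-L) L) {x : Fin n → ℝ}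
    (hx : x ∈ stdSimplex ℝ (Fin n)) : ∃ h ∈ H, ∀ k, cutPoints L x k ∉ h := by
  classical
  by_contra! hcon
  have hlast : Fin.last n ≠ 0 := fun h => hn.ne' (by simpa [Fin.ext_iff] using h)
  have hcover : IsCover H (((Finset.univ.erase 0).erase (Fin.last n)).image (cutPoints L x)) := by
    intro h hh
    obtain ⟨k, hk⟩ := hcon h hh
    refine ⟨_, Finset.mem_image_of_mem _ (Finset.mem_erase.2 ⟨?_, Finset.mem_erase.2
      ⟨?_, Finset.mem_univ _⟩⟩), hk⟩
    · rintro rfl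
      rw [cutPoints_last L hx] at hk
      exact lt_irrefl _ (hL h hh hk).2
    · rintro rfl
      rw [cutPoints_zero] at hk
      exact lt_irrefl _ (hL h hh hk).1
  have h1 := hτ.trans ((piercingNumber_le_card hcover).trans Finset.card_image_le)
  rw [Finset.card_erase_of_mem (Finset.mem_erase.2 ⟨hlast, Finset.mem_univ _⟩),
    Finset.card_erase_of_mem (Finset.mem_univ _), Finset.card_univ, Fintype.card_fin] at h1
  omega

/-- **Tardos–Kaiser theorem.** In every hypergraph `H` of `d`-intervals (`d ≥ 2`),
`τ(H) ≤ (d² - d + 1) ν(H)`. -/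
theorem tardos_kaiser (d : ℕ) (hd : 2 ≤ d) (H : Finset (Set ℝ))
    (hH : ∀ e ∈ H, IsDInterval d e) :
    piercingNumber H ≤ (d ^ 2 - d + 1) * matchingNumber H := by
  classical
  rcases Nat.eq_zero_or_pos (piercingNumber H) with h0 | hn
  · simp [h0]
  obtain ⟨n, hτ⟩ : ∃ n, n = piercingNumber H := ⟨_, rfl⟩
  rw [← hτ] at hn ⊢
  have : Nonempty (Fin n) := ⟨⟨0, hn⟩⟩
  obtain ⟨L, hL0, hL⟩ : ∃ L : ℝ, 0 < L ∧ ∀ h ∈ H, h ⊆ Set.Ioo (-L) L := by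
    obtain ⟨L, hL0, hL⟩ := (H.finite_toSet.isCompact_biUnion fun h hh =>
      (hH h hh).isCompact).isBounded.subset_ball_lt 0 0
    refine ⟨L, hL0, fun h hh p hp => ?_⟩
    have := hL (Set.mem_biUnion hh hp)
    rwa [Real.ball_eq_Ioo, zero_sub, zero_add] at this
  have hgap : ∀ x ∈ stdSimplex ℝ (Fin n), ∀ h ∈ H, (∀ k, cutPoints L x k ∉ h) → ∀ p ∈ h,
      ∃ j : Fin n, p ∈ Set.Ioo (cutPoints L x j.castSucc) (cutPoints L x j.succ) := by
    intro x hx h hh hxh p hp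
    refine exists_gap_of_forall_ne ?_ ?_ fun k hk => hxh k (hk ▸ hp)
    · rw [cutPoints_zero]
      exact (hL h hh hp).1
    · rw [cutPoints_last L hx]
      exact (hL h hh hp).2
  let f : (Fin n → ℝ) → Fin n → ℝ := fun x j =>
    ∑ h ∈ H, if j ∈ hitGaps (cutPoints L x) h then clearance (cutPoints L x) h else 0
  have hite : ∀ x h j, 0 ≤
      if j ∈ hitGaps (cutPoints (n := n) L x) h then clearance (cutPoints L x) h else 0 := by
    intro x h j
    split_ifs
    exacts [clearance_nonneg _ _, le_rfl]
  obtain ⟨x, hx, c, hc, hfc⟩ := exists_forall_eq_of_facet (f := f)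
    (continuous_pi fun j => continuous_finsetSum _ fun h _ =>
      (continuous_ite_clearance h j).comp (continuous_cutPoints L)).continuousOn
    (by
      intro x hx
      obtain ⟨h, hh, hxh⟩ := exists_edge_forall_cutPoints_notMem hn hτ.le hL hx
      obtain ⟨p, hp⟩ := (hH h hh).nonempty
      obtain ⟨j, hj⟩ := hgap x hx h hh hxh p hp
      refine Finset.sum_pos' (fun j _ => Finset.sum_nonneg fun h _ => hite x h j)
        ⟨j, Finset.mem_univ j, Finset.sum_pos' (fun h _ => hite x h j) ⟨h, hh, ?_⟩⟩
      rw [if_pos (mem_hitGaps.2 ⟨p, hp, hj⟩)]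
      exact (clearance_pos_iff (hH h hh).isCompact.isClosed ⟨p, hp⟩).2 hxh)
    (by
      intro x _ j hj
      refine Finset.sum_eq_zero fun h _ => if_neg fun hmem => ?_
      obtain ⟨p, -, hp⟩ := mem_hitGaps.1 hmem
      rw [cutPoints_succ_of_eq_zero L hj] at hp
      exact lt_asymm hp.1 hp.2)
  set t := cutPoints L x
  set E := H.filter fun h => 0 < clearance t h
  have hE : ∀ h ∈ E, h ∈ H ∧ ∀ k, t k ∉ h := fun h hh => by
    rw [Finset.mem_filter] at hh
    exact ⟨hh.1, (clearance_pos_iff (hH h hh.1).isCompact.isClosed (hH h hh.1).nonempty).1 hh.2⟩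
  have hperfect : ∀ j, ∑ h ∈ E with j ∈ hitGaps t h, clearance t h / c = 1 := fun j => by
    rw [← Finset.sum_div, div_eq_one_iff_eq hc.ne', ← hfc j, Finset.sum_filter]
    refine Finset.sum_filter_of_ne fun h _ hne => ?_
    exact lt_of_le_of_ne (clearance_nonneg t h) fun h0 => hne (by rw [← h0, ite_self])
  have hcard : ∀ h ∈ E, (hitGaps t h).card ≤ d := fun h hh =>
    (hH h (hE h hh).1).card_hitGaps_le (monotone_cutPoints hL0 hx) (hE h hh).2
  have hpos : ∀ h ∈ E, 0 < clearance t h / c := fun h hh => div_pos (Finset.mem_filter.1 hh).2 hc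
  obtain ⟨M, hME, hM, hle⟩ := exists_matching_of_fractional (hitGaps t) E
    (fun h => clearance t h / c)
    (fun h hh => by
      obtain ⟨p, hp⟩ := (hH h (hE h hh).1).nonempty
      obtain ⟨j, hj⟩ := hgap x hx h (hE h hh).1 (hE h hh).2 p hp
      exact ⟨j, mem_hitGaps.2 ⟨p, hp, hj⟩⟩)
    hcard hpos fun j => (hperfect j).le
  have hmatching : IsMatching H M := by
    refine ⟨fun h hh => (hE h (hME hh)).1, fun e he e' he' hne => ?_⟩
    refine Set.disjoint_left.2 fun p hp hp' => ?_
    obtain ⟨j, hj⟩ := hgap x hx e (hE e (hME he)).1 (hE e (hME he)).2 p hp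
    exact Finset.disjoint_left.1 (hM e he e' he' hne) (mem_hitGaps.2 ⟨p, hp, hj⟩)
      (mem_hitGaps.2 ⟨p, hp', hj⟩)
  have hsum : (n : ℝ) ≤ d * ∑ h ∈ E, clearance t h / c := by
    calc (n : ℝ) = ∑ j : Fin n, ∑ h ∈ E with j ∈ hitGaps t h, clearance t h / c := by
          simp [hperfect]
      _ = ∑ h ∈ E, (hitGaps t h).card * (clearance t h / c) := by
          simp only [Finset.sum_filter]
          rw [Finset.sum_comm]
          simp [Finset.sum_ite_mem]
      _ ≤ ∑ h ∈ E, d * (clearance t h / c) := Finset.sum_le_sum fun h hh =>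
          mul_le_mul_of_nonneg_right (by exact_mod_cast hcard h hh) (hpos h hh).le
      _ = d * ∑ h ∈ E, clearance t h / c := (Finset.mul_sum _ _ _).symm
  have hfinal : n ≤ (d ^ 2 - d + 1) * M.card := by
    have hdd : d ≤ d ^ 2 := Nat.le_self_pow two_ne_zero d
    have := hsum.trans hle
    rw [← Nat.cast_le (α := ℝ)]
    push_cast [Nat.cast_sub hdd]
    exact this
  exact hfinal.trans (Nat.mul_le_mul_left _ (card_le_matchingNumber hmatching))
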